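/- Let t be a rational number with t ≠ 1 and t ≠ 2, let α ∈ ℂ be a root of f_t, and set β = a₀ + a₁α + a₂α² + a₃α³ + a₄α⁴ + a₅α⁵. Then in ℂ[X] one has the factorization f_t = (X−α)(X−β)(X−β/α)(X−1/α)(X−1/β)(X−α/β), and the six complex numbers α, β, β/α, 1/α, 1/β, α/β are pairwise distinct (in particular α ≠ 0 and β ≠ 0). -/

import Mathlib

open Polynomial

noncomputable def u (t : ℚ) : ℚ := (3*t^2 - 2*t + 2) / (t^2 + t - 1)

noncomputable def v (t : ℚ) : ℚ :=
  (t^5 - 5*t^4 + 10*t^3 - 20*t^2 + 15*t - 7) / ((t - 2) * (t^2 + t - 1)^2)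

noncomputable def w (t : ℚ) : ℚ :=
  (-3*t^5 + 10*t^4 - 20*t^3 + 20*t^2 - 20*t + 6) / ((t - 2) * (t^2 + t - 1)^2)

/-- The polynomial `f_t = X⁶ + uX⁵ + vX⁴ + wX³ + vX² + uX + 1 ∈ ℚ[X]`. -/
noncomputable def f (t : ℚ) : Polynomial ℚ :=
  X^6 + C (u t) * X^5 + C (v t) * X^4 + C (w t) * X^3 + C (v t) * X^2 + C (u t) * X + 1

noncomputable def s (t : ℚ) : ℚ := (t^4 - 3*t^3 - t^2 + 3*t + 1) * (t - 2)

noncomputable def a0 (t : ℚ) : ℚ := -((t^2 + 1) * (t^3 - t^2 + 2*t - 3)) / s t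

noncomputable def a1 (t : ℚ) : ℚ :=
  -(3*t^7 - 9*t^6 + 16*t^5 - 15*t^4 + 10*t^3 - 11*t^2 + 8*t - 7) / ((t^2 + t - 1) * s t)

noncomputable def a2 (t : ℚ) : ℚ :=
  (2*t^8 - 14*t^7 + 52*t^6 - 99*t^5 + 100*t^4 - 54*t^3 + 38*t^2 - 44*t + 13) /
    ((t^2 + t - 1) * (t - 2) * s t)

noncomputable def a3 (t : ℚ) : ℚ :=
  (t^8 + t^7 - 21*t^6 + 65*t^5 - 90*t^4 + 78*t^3 - 57*t^2 + 32*t - 15) /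
    ((t^2 + t - 1) * (t - 2) * s t)

noncomputable def a4 (t : ℚ) : ℚ := -(2*t^5 - 6*t^4 + 13*t^3 - 14*t^2 + 7*t - 5) / s t

noncomputable def a5 (t : ℚ) : ℚ := -((t^2 + t - 1) * (t^3 - t^2 + 2*t - 3)) / s t


lemma ratform_ne (t : ℚ) : t^2 + t - 1 ≠ 0 ∧ t^4 - 3*t^3 - t^2 + 3*t + 1 ≠ 0 ∧
    7*t^5 - 10*t^4 - 20*t^3 - 4 ≠ 0 := by
  have hd : (t.den : ℚ) ≠ 0 := by exact_mod_cast t.den_nz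
  have ht : t = (t.num : ℚ) / (t.den : ℚ) := (Rat.num_div_den t).symm
  have hc : ¬ ((2:ℤ) ∣ t.num ∧ (2:ℤ) ∣ (t.den : ℤ)) := by
    rintro ⟨h1, h2⟩
    have h3 : (2:ℕ) ∣ t.num.natAbs := by omega
    have h4 : (2:ℕ) ∣ t.den := by omega
    have := Nat.dvd_gcd h3 h4
    rw [t.reduced] at this
    omega
  generalize t.num = p at *
  generalize hk : (t.den : ℤ) = k at *
  have hk' : (t.den : ℚ) = (k : ℚ) := by rw [← hk]; simp
  rw [hk'] at hd ht
  subst ht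
  have hpar : p % 2 = 0 ∨ p % 2 = 1 := by omega
  have hkar : k % 2 = 0 ∨ k % 2 = 1 := by omega
  refine ⟨fun h => ?_, fun h => ?_, fun h => ?_⟩
  · field_simp at h
    have h' : p^2 + p*k - k^2 = 0 := by
      have : (p:ℚ)^2 + p*k - k^2 = 0 := by linear_combination h
      exact_mod_cast this
    have h2 : (p^2 + p*k - k^2) % 2 = 0 := by rw [h']; rfl
    rcases hpar with a | a <;> rcases hkar with b | b
    · omega
    all_goals simp [pow_succ, Int.add_emod, Int.sub_emod, Int.mul_emod, a, b] at h2
  · field_simp at h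
    have h' : p^4 - 3*p^3*k - p^2*k^2 + 3*p*k^3 + k^4 = 0 := by
      have : (p:ℚ)^4 - 3*p^3*k - p^2*k^2 + 3*p*k^3 + k^4 = 0 := by linear_combination h
      exact_mod_cast this
    have h2 : (p^4 - 3*p^3*k - p^2*k^2 + 3*p*k^3 + k^4) % 2 = 0 := by rw [h']; rfl
    rcases hpar with a | a <;> rcases hkar with b | b
    · omega
    all_goals simp [pow_succ, Int.add_emod, Int.sub_emod, Int.mul_emod, a, b] at h2
  · field_simp at h
    have h' : 7*p^5 - 10*p^4*k - 20*p^3*k^2 - 4*k^5 = 0 := by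
      have : 7*(p:ℚ)^5 - 10*p^4*k - 20*p^3*k^2 - 4*k^5 = 0 := by linear_combination h
      exact_mod_cast this
    have hp : (2:ℤ) ∣ p := by
      have : (2:ℤ) ∣ p^5 :=
        ⟨-3*p^5 + 5*p^4*k + 10*p^3*k^2 + 2*k^5, by linear_combination h'⟩
      exact Int.prime_two.dvd_of_dvd_pow this
    obtain ⟨m, rfl⟩ := hp
    have hk2 : (2:ℤ) ∣ k := by
      have : (2:ℤ) ∣ k^5 :=
        ⟨28*m^5 - 20*m^4*k - 20*m^3*k^2, by linarith⟩
      exact Int.prime_two.dvd_of_dvd_pow this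
    exact hc ⟨⟨m, rfl⟩, hk2⟩

/-- The parameters `u, v, w` with denominators cleared, and their consequences. -/
lemma uvw_facts (t : ℚ) (h1 : t ≠ 1) (h2 : t ≠ 2) :
    2 * u t - w t = u t ^ 2 - 2 * v t + 2 ∧ 2 + 2 * u t + 2 * v t + w t ≠ 0 ∧
    2 - 2 * u t + 2 * v t - w t ≠ 0 ∧ (v t + 9 - 5 * u t)^2 ≠ 4 * (3 - u t)^3 := by
  obtain ⟨hq, hg, hf⟩ := ratform_ne t
  have hd : t - 2 ≠ 0 := sub_ne_zero.mpr h2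
  have h1' : t - 1 ≠ 0 := sub_ne_zero.mpr h1
  have hu : u t * (t^2 + t - 1) = 3*t^2 - 2*t + 2 := div_mul_cancel₀ _ hq
  have hv : v t * ((t - 2) * (t^2 + t - 1)^2) =
      t^5 - 5*t^4 + 10*t^3 - 20*t^2 + 15*t - 7 := by unfold v; exact div_mul_cancel₀ _ (by repeat' first | exact hq | exact hd | apply pow_ne_zero | apply mul_ne_zero)
  have hw : w t * ((t - 2) * (t^2 + t - 1)^2) =
      -3*t^5 + 10*t^4 - 20*t^3 + 20*t^2 - 20*t + 6 := by unfold w; exact div_mul_cancel₀ _ (by repeat' first | exact hq | exact hd | apply pow_ne_zero | apply mul_ne_zero)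
  have hD : (t - 2) * (t^2 + t - 1)^2 ≠ 0 := by positivity
  generalize u t = U at *
  generalize v t = V at *
  generalize w t = W at *
  refine ⟨?_, fun h => hf ?_, fun h => pow_ne_zero 5 hd ?_, fun h => ?_⟩
  · apply mul_left_cancel₀ hD
    linear_combination (2*(t-2)*(t^2+t-1) - (t-2)*(U*(t^2+t-1) + (3*t^2 - 2*t + 2))) * hu
      - hw + 2*hv
  · linear_combination ((t - 2) * (t^2 + t - 1)^2) * h - 2*(t-2)*(t^2+t-1)*hu - 2*hv - hw
  · linear_combination ((t - 2) * (t^2 + t - 1)^2) * h + 2*(t-2)*(t^2+t-1)*hu - 2*hv + hw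
  · have hA : (V + 9 - 5*U) * ((t - 2) * (t^2 + t - 1)^2) =
        (t^5 - 5*t^4 + 10*t^3 - 20*t^2 + 15*t - 7) + 9 * ((t - 2) * (t^2 + t - 1)^2)
        - 5 * ((3*t^2 - 2*t + 2) * ((t - 2) * (t^2 + t - 1))) := by
      linear_combination hv - 5*(t-2)*(t^2+t-1)*hu
    have hB : (3 - U) * (t^2 + t - 1) = 5 * (t - 1) := by linear_combination -hu
    have key : 25 * ((t - 1) * (t^4 - 3*t^3 - t^2 + 3*t + 1))^2 = 0 := by
      have e1 : ((V + 9 - 5*U) * ((t - 2) * (t^2 + t - 1)^2))^2 =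
        4 * ((3 - U) * (t^2 + t - 1))^3 * ((t - 2)^2 * (t^2 + t - 1)) := by
        linear_combination ((t - 2) * (t^2 + t - 1)^2)^2 * h
      rw [hA, hB] at e1
      linear_combination e1
    have : (t - 1) * (t^4 - 3*t^3 - t^2 + 3*t + 1) ≠ 0 := mul_ne_zero h1' hg
    exact absurd key (by positivity)

set_option maxHeartbeats 4000000 in
/-- The quadratic relation between `α` and `β`, with denominators cleared. -/
lemma cleared_relation (t x N L F : ℂ)
    (hL : L = (t^2 + t - 1) * (t - 2)^2 * (t^4 - 3*t^3 - t^2 + 3*t + 1))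
    (hN : N = -((t^2 + 1) * (t^3 - t^2 + 2*t - 3) * (t^2 + t - 1) * (t - 2))
      - (3*t^7 - 9*t^6 + 16*t^5 - 15*t^4 + 10*t^3 - 11*t^2 + 8*t - 7) * (t - 2) * x
      + (2*t^8 - 14*t^7 + 52*t^6 - 99*t^5 + 100*t^4 - 54*t^3 + 38*t^2 - 44*t + 13) * x^2
      + (t^8 + t^7 - 21*t^6 + 65*t^5 - 90*t^4 + 78*t^3 - 57*t^2 + 32*t - 15) * x^3
      - (2*t^5 - 6*t^4 + 13*t^3 - 14*t^2 + 7*t - 5) * (t^2 + t - 1) * (t - 2) * x^4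
      - (t^2 + t - 1)^2 * (t^3 - t^2 + 2*t - 3) * (t - 2) * x^5)
    (hF : F = (t - 2) * (t^2 + t - 1)^2 * (x^6 + 1)
      + (3*t^2 - 2*t + 2) * (t - 2) * (t^2 + t - 1) * (x^5 + x)
      + (t^5 - 5*t^4 + 10*t^3 - 20*t^2 + 15*t - 7) * (x^4 + x^2)
      + (-3*t^5 + 10*t^4 - 20*t^3 + 20*t^2 - 20*t + 6) * x^3) :
    N^2 * (x + 1) * (t^2 + t - 1) + N * L * ((t^2 + t - 1) * (x^2 + 1) + (3*t^2 - 2*t + 2) * x)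
      + L^2 * (t^2 + t - 1) * (x * (x + 1)) = (
    ((-6)*t^0 + (49)*t^1 + (-113)*t^2 + (131)*t^3 + (-127)*t^4 + (80)*t^5 + (-7)*t^6 + (-16)*t^7 + (17)*t^8 + (-14)*t^9 + (4)*t^10)*x^0 +
    ((-6)*t^0 + (-99)*t^1 + (119)*t^2 + (42)*t^3 + (26)*t^4 + (-336)*t^5 + (418)*t^6 + (-217)*t^7 + (44)*t^8 + (7)*t^9 + (-8)*t^10 + (2)*t^11)*x^1 +
    ((3)*t^0 + (-70)*t^1 + (-26)*t^2 + (242)*t^3 + (-279)*t^4 + (145)*t^5 + (49)*t^6 + (-182)*t^7 + (169)*t^8 + (-78)*t^9 + (18)*t^10 + (-2)*t^11)*x^2 +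
    ((-5)*t^0 + (-30)*t^1 + (52)*t^2 + (-34)*t^3 + (-127)*t^4 + (354)*t^5 + (-403)*t^6 + (289)*t^7 + (-138)*t^8 + (36)*t^9 + (-2)*t^10 + (-1)*t^11)*x^3 +
    ((6)*t^0 + (-7)*t^1 + (70)*t^2 + (-260)*t^3 + (315)*t^4 + (-181)*t^5 + (62)*t^6 + (15)*t^7 + (-45)*t^8 + (30)*t^9 + (-11)*t^10 + (2)*t^11)*x^4 +
    ((-18)*t^0 + (69)*t^1 + (-80)*t^2 + (25)*t^3 + (0)*t^4 + (-12)*t^5 + (26)*t^6 + (-10)*t^7 + (0)*t^8 + (0)*t^9 + (-2)*t^10 + (1)*t^11)*x^5) * (t^2 + t - 1) * F := by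
  subst hL hN hF
  ring

/-- If `t ≠ 1, 2` is rational, `α ∈ ℂ` is a root of `f t` and
`β = a₀ + a₁α + a₂α² + a₃α³ + a₄α⁴ + a₅α⁵`, then over `ℂ` one has
`f t = (X−α)(X−β)(X−β/α)(X−1/α)(X−1/β)(X−α/β)` and the six numbers
`α, β, β/α, 1/α, 1/β, α/β` are pairwise distinct (in particular `α ≠ 0` and `β ≠ 0`). -/
theorem f_factorization (t : ℚ) (h1 : t ≠ 1) (h2 : t ≠ 2) (α : ℂ)
    (hα : Polynomial.aeval α (f t) = 0)
    (β : ℂ)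
    (hβ : β = (a0 t : ℂ) + (a1 t : ℂ) * α + (a2 t : ℂ) * α^2 + (a3 t : ℂ) * α^3
      + (a4 t : ℂ) * α^4 + (a5 t : ℂ) * α^5) :
    α ≠ 0 ∧ β ≠ 0 ∧
    (f t).map (algebraMap ℚ ℂ) =
      (X - C α) * (X - C β) * (X - C (β/α)) * (X - C (1/α)) * (X - C (1/β)) * (X - C (α/β)) ∧
    List.Pairwise (· ≠ ·) [α, β, β/α, 1/α, 1/β, α/β] := by
  obtain ⟨hq, hg, -⟩ := ratform_ne t
  obtain ⟨hrel, hf1, hfm1, hdisc⟩ := uvw_facts t h1 h2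
  have hd : t - 2 ≠ 0 := sub_ne_zero.mpr h2
  have hqC : (t:ℂ)^2 + t - 1 ≠ 0 := by exact_mod_cast hq
  have hgC : (t:ℂ)^4 - 3*t^3 - t^2 + 3*t + 1 ≠ 0 := by exact_mod_cast hg
  have hdC : (t:ℂ) - 2 ≠ 0 := by exact_mod_cast hd
  have hf : α^6 + (u t : ℂ) * α^5 + (v t : ℂ) * α^4 + (w t : ℂ) * α^3 + (v t : ℂ) * α^2
      + (u t : ℂ) * α + 1 = 0 := by
    simpa [f] using hα
  have hα0 : α ≠ 0 := by
    rintro rfl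
    simp at hf
  have hα1 : α + 1 ≠ 0 := by
    intro h
    have : α = -1 := by linear_combination h
    subst this
    apply hfm1
    have : (2 - 2 * (u t : ℂ) + 2 * (v t : ℂ) - (w t : ℂ)) = 0 := by linear_combination hf
    exact_mod_cast this
  -- the quadratic relation
  have hu : (u t : ℂ) * (t^2 + t - 1) = 3*t^2 - 2*t + 2 := by
    unfold u; push_cast; exact div_mul_cancel₀ _ (by repeat' first | exact hqC | exact hgC | exact hdC | apply pow_ne_zero | apply mul_ne_zero)
  have hv : (v t : ℂ) * ((t - 2) * (t^2 + t - 1)^2) =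
      t^5 - 5*t^4 + 10*t^3 - 20*t^2 + 15*t - 7 := by unfold v; push_cast; exact div_mul_cancel₀ _ (by repeat' first | exact hqC | exact hgC | exact hdC | apply pow_ne_zero | apply mul_ne_zero)
  have hw : (w t : ℂ) * ((t - 2) * (t^2 + t - 1)^2) =
      -3*t^5 + 10*t^4 - 20*t^3 + 20*t^2 - 20*t + 6 := by unfold w; push_cast; exact div_mul_cancel₀ _ (by repeat' first | exact hqC | exact hgC | exact hdC | apply pow_ne_zero | apply mul_ne_zero)
  have hE : β^2 * (α + 1) + β * (α^2 + (u t : ℂ) * α + 1) + α * (α + 1) = 0 := by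
    have hc := cleared_relation t α _ _ _ rfl rfl rfl
    rw [show (t - 2 : ℂ) * (t^2 + t - 1)^2 * (α^6 + 1)
      + (3*t^2 - 2*t + 2) * (t - 2) * (t^2 + t - 1) * (α^5 + α)
      + (t^5 - 5*t^4 + 10*t^3 - 20*t^2 + 15*t - 7) * (α^4 + α^2)
      + (-3*t^5 + 10*t^4 - 20*t^3 + 20*t^2 - 20*t + 6) * α^3 = 0 by
        rw [← hu, ← hv, ← hw]
        linear_combination ((t - 2 : ℂ) * (t^2 + t - 1)^2) * hf, mul_zero] at hc
    have hL : ((t:ℂ)^2 + t - 1) * (t - 2)^2 * (t^4 - 3*t^3 - t^2 + 3*t + 1) ≠ 0 :=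
      mul_ne_zero (mul_ne_zero hqC (pow_ne_zero 2 hdC)) hgC
    have hN : ((t:ℂ)^2 + t - 1) * (t - 2)^2 * (t^4 - 3*t^3 - t^2 + 3*t + 1) * β =
      -((t^2 + 1) * (t^3 - t^2 + 2*t - 3) * (t^2 + t - 1) * (t - 2))
      - (3*t^7 - 9*t^6 + 16*t^5 - 15*t^4 + 10*t^3 - 11*t^2 + 8*t - 7) * (t - 2) * α
      + (2*t^8 - 14*t^7 + 52*t^6 - 99*t^5 + 100*t^4 - 54*t^3 + 38*t^2 - 44*t + 13) * α^2
      + (t^8 + t^7 - 21*t^6 + 65*t^5 - 90*t^4 + 78*t^3 - 57*t^2 + 32*t - 15) * α^3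
      - (2*t^5 - 6*t^4 + 13*t^3 - 14*t^2 + 7*t - 5) * (t^2 + t - 1) * (t - 2) * α^4
      - (t^2 + t - 1)^2 * (t^3 - t^2 + 2*t - 3) * (t - 2) * α^5 := by
      have ha0 : (a0 t : ℂ) * ((t^4 - 3*t^3 - t^2 + 3*t + 1) * (t - 2)) =
          -((t^2 + 1) * (t^3 - t^2 + 2*t - 3)) := by
        unfold a0 s; push_cast; exact div_mul_cancel₀ _ (by repeat' first | exact hqC | exact hgC | exact hdC | apply pow_ne_zero | apply mul_ne_zero)
      have ha1 : (a1 t : ℂ) * ((t^2 + t - 1) * ((t^4 - 3*t^3 - t^2 + 3*t + 1) * (t - 2))) =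
          -(3*t^7 - 9*t^6 + 16*t^5 - 15*t^4 + 10*t^3 - 11*t^2 + 8*t - 7) := by
        unfold a1 s; push_cast; exact div_mul_cancel₀ _ (by repeat' first | exact hqC | exact hgC | exact hdC | apply pow_ne_zero | apply mul_ne_zero)
      have ha2 : (a2 t : ℂ) * ((t^2 + t - 1) * (t - 2) *
          ((t^4 - 3*t^3 - t^2 + 3*t + 1) * (t - 2))) =
          2*t^8 - 14*t^7 + 52*t^6 - 99*t^5 + 100*t^4 - 54*t^3 + 38*t^2 - 44*t + 13 := by
        unfold a2 s; push_cast; exact div_mul_cancel₀ _ (by repeat' first | exact hqC | exact hgC | exact hdC | apply pow_ne_zero | apply mul_ne_zero)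
      have ha3 : (a3 t : ℂ) * ((t^2 + t - 1) * (t - 2) *
          ((t^4 - 3*t^3 - t^2 + 3*t + 1) * (t - 2))) =
          t^8 + t^7 - 21*t^6 + 65*t^5 - 90*t^4 + 78*t^3 - 57*t^2 + 32*t - 15 := by
        unfold a3 s; push_cast; exact div_mul_cancel₀ _ (by repeat' first | exact hqC | exact hgC | exact hdC | apply pow_ne_zero | apply mul_ne_zero)
      have ha4 : (a4 t : ℂ) * ((t^4 - 3*t^3 - t^2 + 3*t + 1) * (t - 2)) =
          -(2*t^5 - 6*t^4 + 13*t^3 - 14*t^2 + 7*t - 5) := by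
        unfold a4 s; push_cast; exact div_mul_cancel₀ _ (by repeat' first | exact hqC | exact hgC | exact hdC | apply pow_ne_zero | apply mul_ne_zero)
      have ha5 : (a5 t : ℂ) * ((t^4 - 3*t^3 - t^2 + 3*t + 1) * (t - 2)) =
          -((t^2 + t - 1) * (t^3 - t^2 + 2*t - 3)) := by
        unfold a5 s; push_cast; exact div_mul_cancel₀ _ (by repeat' first | exact hqC | exact hgC | exact hdC | apply pow_ne_zero | apply mul_ne_zero)
      rw [hβ]
      linear_combination (t^2 + t - 1 : ℂ) * (t - 2) * ha0 + (t - 2 : ℂ) * α * ha1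
        + α^2 * ha2 + α^3 * ha3 + (t^2 + t - 1 : ℂ) * (t - 2) * α^4 * ha4
        + (t^2 + t - 1 : ℂ) * (t - 2) * α^5 * ha5
    rw [← hN, ← hu] at hc
    apply mul_left_cancel₀ (mul_ne_zero hqC (pow_ne_zero 2 hL))
    linear_combination hc
  clear hβ hu hv hw hα
  have hβ0 : β ≠ 0 := by
    rintro rfl
    have : α * (α + 1) = 0 := by linear_combination hE
    exact mul_ne_zero hα0 hα1 this
  have hrelC : 2 * (u t : ℂ) - w t = (u t : ℂ)^2 - 2 * v t + 2 := by exact_mod_cast hrel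
  have hf1C : 2 + 2 * (u t : ℂ) + 2 * v t + w t ≠ 0 := by exact_mod_cast hf1
  have hfm1C : 2 - 2 * (u t : ℂ) + 2 * v t - w t ≠ 0 := by exact_mod_cast hfm1
  have hdiscC : ((v t : ℂ) + 9 - 5 * u t)^2 ≠ 4 * (3 - u t)^3 := by exact_mod_cast hdisc
  have hmap : (f t).map (algebraMap ℚ ℂ) = X^6 + C (u t : ℂ) * X^5 + C (v t : ℂ) * X^4
      + C (w t : ℂ) * X^3 + C (v t : ℂ) * X^2 + C (u t : ℂ) * X + 1 := by
    simp [f]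
  rw [hmap]
  generalize (u t : ℂ) = U at *
  generalize (v t : ℂ) = V at *
  generalize (w t : ℂ) = W at *
  clear hmap
  obtain ⟨y, hy⟩ : ∃ y, y = α + 1/α := ⟨_, rfl⟩
  obtain ⟨z, hz⟩ : ∃ z, z = β + 1/β := ⟨_, rfl⟩
  obtain ⟨r, hr⟩ : ∃ r, r = β/α + α/β := ⟨_, rfl⟩
  have e1 : y + z + r = -U := by
    rw [hy, hz, hr]; field_simp; linear_combination hE
  have hM : y^2 + z^2 + r^2 - y*z*r = 4 := by
    rw [hy, hz, hr]; field_simp; ring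
  have hcub : y^3 + U*y^2 + (V - 3)*y + (W - 2*U) = 0 := by
    rw [hy]; field_simp; linear_combination hf
  have hy2 : y + 2 ≠ 0 := by
    intro h
    apply pow_ne_zero 2 hα1
    rw [hy] at h; field_simp at h; linear_combination h
  have e2 : y*z + y*r + z*r = V - 3 := by
    apply mul_left_cancel₀ hy2
    have hU : U = -(y + z + r) := by linear_combination e1
    subst hU
    linear_combination -hM - hcub - hrelC
  have e3 : y*z*r = 2*U - W := by
    have hU : U = -(y + z + r) := by linear_combination e1
    subst hU
    linear_combination -hM - hrelC - 2 * e2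
  have bad : ∀ a : ℂ, a^2 + 2*a - 2 = -U → a^2 + 2*a*(a^2 - 2) = V - 3 → False := by
    intro a ha hb
    apply hdiscC
    have hU : U = -(a^2 + 2*a - 2) := by linear_combination ha
    have hV : V = a^2 + 2*a*(a^2 - 2) + 3 := by linear_combination -hb
    subst hU hV
    ring
  have p1 : (2 - y) * (2 - z) * (2 - r) ≠ 0 := by
    intro h; apply hf1C; linear_combination h + 4 * e1 - 2 * e2 + e3
  have p2 : (2 + y) * (2 + z) * (2 + r) ≠ 0 := by
    intro h; apply hfm1C; linear_combination h - 4 * e1 - 2 * e2 - e3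
  have hsq : ∀ a : ℂ, a ≠ 0 → 2 - (a + 1/a) ≠ 0 → 2 + (a + 1/a) ≠ 0 → a ≠ 1 ∧ a^2 ≠ 1 := by
    intro a ha hm hp
    have A : a ≠ 1 := by rintro rfl; apply hm; norm_num
    refine ⟨A, fun h => ?_⟩
    rcases mul_self_eq_one_iff.mp (by rw [← sq]; exact h : a * a = 1) with h | h
    · exact A h
    · subst h; apply hp; norm_num
  obtain ⟨hαa, hαb⟩ := hsq α hα0 (by rw [← hy]; exact fun h => p1 (by rw [h]; ring))
    (by rw [← hy]; exact fun h => p2 (by rw [h]; ring))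
  obtain ⟨hβa, hβb⟩ := hsq β hβ0 (by rw [← hz]; exact fun h => p1 (by rw [h]; ring))
    (by rw [← hz]; exact fun h => p2 (by rw [h]; ring))
  have hr' : r = β/α + 1/(β/α) := by rw [hr, one_div_div]
  obtain ⟨hγa, hγb⟩ := hsq (β/α) (div_ne_zero hβ0 hα0)
    (by rw [← hr']; exact fun h => p1 (by rw [h]; ring))
    (by rw [← hr']; exact fun h => p2 (by rw [h]; ring))
  have hne : α ≠ β := fun h => hγa (by rw [h]; exact div_self hβ0)
  have hsqne : α^2 ≠ β^2 := fun h => hγb (by rw [div_pow, h]; exact div_self (pow_ne_zero 2 hβ0))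
  have b1 : β ≠ α^2 := by
    intro h
    have hr2 : r = y := by rw [hr, hy, h]; field_simp; try ring
    have hz2 : z = y^2 - 2 := by rw [hz, hy, h]; field_simp; ring
    rw [hr2, hz2] at e1 e2
    exact bad y (by linear_combination e1) (by linear_combination e2)
  have b2 : α * β ≠ 1 := by
    intro h
    have hb : β = 1/α := by field_simp; linear_combination h
    have hr2 : z = y := by rw [hz, hy, hb]; field_simp; try ring
    have hz2 : r = y^2 - 2 := by rw [hr, hy, hb]; field_simp; ring
    rw [hr2, hz2] at e1 e2
    exact bad y (by linear_combination e1) (by linear_combination e2)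
  have b3 : α ≠ β^2 := by
    intro h
    have hr2 : r = z := by rw [hr, hz, h]; field_simp; try ring
    have hz2 : y = z^2 - 2 := by rw [hy, hz, h]; field_simp; ring
    rw [hr2, hz2] at e1 e2
    exact bad z (by linear_combination e1) (by linear_combination e2)
  refine ⟨hα0, hβ0, ?_, ?_⟩
  · have q1 : (X - C α) * (X - C (1/α)) = X^2 - C y * X + 1 := by
      have : C α * C (1/α) = (1 : ℂ[X]) := by rw [← C_mul, mul_one_div_cancel hα0, C_1]
      rw [hy, C_add]; linear_combination this
    have q2 : (X - C β) * (X - C (1/β)) = X^2 - C z * X + 1 := by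
      have : C β * C (1/β) = (1 : ℂ[X]) := by rw [← C_mul, mul_one_div_cancel hβ0, C_1]
      rw [hz, C_add]; linear_combination this
    have q3 : (X - C (β/α)) * (X - C (α/β)) = X^2 - C r * X + 1 := by
      have : C (β/α) * C (α/β) = (1 : ℂ[X]) := by
        rw [← C_mul, div_mul_div_cancel₀ hα0, div_self hβ0, C_1]
      rw [hr, C_add]; linear_combination this
    have c1 : C y + C z + C r = -C U := by simpa using congrArg C e1
    have c2 : C y * C z + C y * C r + C z * C r = C V - 3 := by
      simpa [map_ofNat C 3] using congrArg C e2
    have c3 : C y * C z * C r = 2 * C U - C W := by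
      simpa [map_ofNat C 2] using congrArg C e3
    calc _ = (X^2 - C y * X + 1) * (X^2 - C z * X + 1) * (X^2 - C r * X + 1) := by
          linear_combination (X^5 + 2*X^3 + X) * c1 - (X^4 + X^2) * c2 + X^3 * c3
      _ = _ := by rw [← q1, ← q2, ← q3]; ring
  · simp only [List.pairwise_cons, List.mem_cons, List.not_mem_nil, or_false,
      forall_eq_or_imp, forall_eq, ne_eq, IsEmpty.forall_iff, implies_true, List.Pairwise.nil,
      and_true]
    clear hy hz hr hr' e1 e2 e3 hM hcub hy2 bad p1 p2 hsq hγa hγb hf hE hrelC hf1C hfm1C hdiscC hdisc hrel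
    clear hf1 hfm1 hqC hgC hdC hq hg hd h1 h2 hα1
    refine ⟨⟨?_, ?_, ?_, ?_, ?_⟩, ⟨?_, ?_, ?_, ?_⟩, ⟨?_, ?_, ?_⟩, ⟨?_, ?_⟩, ?_⟩ <;>
      intro h <;> (try field_simp at h) <;> grind
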